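/- Weighted estimate for the potential term: let θ∈ℝ and γ>0, and set |g|²_{L²_{σ̃,θ}} = ∫_{ℝ³}⟨v⟩^{2θ}|∇_v g|² dv + ∫_{ℝ³}⟨v⟩^{2θ}(|v|²⟨v⟩^{2γ−4}/2)|g|² dv. There exists a constant C>0 such that for every m>1 there is a constant C(m)>0 (with 0<C(m)<∞) so that for all smooth rapidly decaying g₁,g₂:ℝ³→ℝ, |∫_{ℝ³}⟨v⟩^{2θ}(Δ_vΦ(v)/2) g₁(v) g₂(v) dv| ≤ (C/m^γ)|g₁|_{L²_{σ̃,θ}}|g₂|_{L²_{σ̃,θ}} + C(m)(∫_{|v|≤m}⟨v⟩^{2θ}|g₁|² dv)^{1/2}(∫_{|v|≤m}⟨v⟩^{2θ}|g₂|² dv)^{1/2}. -/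

import Mathlib

open MeasureTheory Real
open scoped RealInnerProductSpace

noncomputable section

abbrev V3 := EuclideanSpace ℝ (Fin 3)

/-- Japanese bracket `⟨v⟩ = (1+|v|²)^{1/2}`. -/
def jap (v : V3) : ℝ := Real.sqrt (1 + ‖v‖ ^ 2)

/-- Laplacian in the velocity variable. -/
def lap (g : V3 → ℝ) (v : V3) : ℝ :=
  ∑ i : Fin 3,
    fderiv ℝ (fun w => fderiv ℝ g w (EuclideanSpace.single i 1)) v (EuclideanSpace.single i 1)

/-- The potential `Φ(v) = (1/γ)⟨v⟩^γ + Φ₀`. -/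
def Phi (γ Φ0 : ℝ) (v : V3) : ℝ := (1 / γ) * jap v ^ γ + Φ0

/-- `M(v)^{1/2} = exp(-Φ(v)/2)`. -/
def sqrtM (γ Φ0 : ℝ) (v : V3) : ℝ := Real.exp (-(Phi γ Φ0 v) / 2)

/-- The linearized Fokker–Planck operator. -/
def Lop (γ : ℝ) (g : V3 → ℝ) (v : V3) : ℝ :=
  lap g v +
    (-(1 / 4) * ‖v‖ ^ 2 * jap v ^ (2 * γ - 4) +
      ((3 / 2) * jap v ^ (γ - 2) + ((γ - 2) / 2) * ‖v‖ ^ 2 * jap v ^ (γ - 4))) * g v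

/-- Macroscopic projection `P₀`. -/
def P0 (γ Φ0 : ℝ) (g : V3 → ℝ) (v : V3) : ℝ :=
  (∫ w : V3, g w * sqrtM γ Φ0 w) * sqrtM γ Φ0 v

/-- Microscopic projection `P₁ = Id - P₀`. -/
def P1 (γ Φ0 : ℝ) (g : V3 → ℝ) (v : V3) : ℝ := g v - P0 γ Φ0 g v

/-- A smooth non-increasing cutoff, `χ = 1` on `(-∞,1]`, `χ = 0` on `[2,∞)`. -/
structure IsCutoff (χ : ℝ → ℝ) : Prop where
  smooth : ContDiff ℝ (⊤ : ℕ∞) χ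
  anti : Antitone χ
  eq_one : ∀ s : ℝ, s ≤ 1 → χ s = 1
  eq_zero : ∀ s : ℝ, 2 ≤ s → χ s = 0
  nonneg : ∀ s : ℝ, 0 ≤ χ s
  le_one : ∀ s : ℝ, χ s ≤ 1

/-- `K g = ϖ χ_R(|v|) g`. -/
def Kop (ϖ R : ℝ) (χ : ℝ → ℝ) (g : V3 → ℝ) (v : V3) : ℝ := ϖ * χ (‖v‖ / R) * g v

/-- `Λ g = -L g + ϖ χ_R(|v|) g`. -/
def Lam (γ ϖ R : ℝ) (χ : ℝ → ℝ) (g : V3 → ℝ) (v : V3) : ℝ :=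
  -(Lop γ g v) + Kop ϖ R χ g v

/-- Rapid decay (together with all derivatives) in the `(x,v)` variables. -/
def RapidDecay (g : V3 → V3 → ℝ) : Prop :=
  ∀ k n : ℕ, ∃ C : ℝ, ∀ x v : V3,
    (1 + ‖x‖ + ‖v‖) ^ k * ‖iteratedFDeriv ℝ n (fun p : V3 × V3 => g p.1 p.2) (x, v)‖ ≤ C

/-- Smooth rapidly-decaying solution of `∂ₜ h + v·∇ₓ h + Λ h = src`. -/
def IsDampedSol (γ ϖ R : ℝ) (χ : ℝ → ℝ) (src : ℝ → V3 → V3 → ℝ)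
    (h : ℝ → V3 → V3 → ℝ) : Prop :=
  ContDiff ℝ (⊤ : ℕ∞) (fun p : ℝ × V3 × V3 => h p.1 p.2.1 p.2.2) ∧
  (∀ t : ℝ, RapidDecay (h t)) ∧
  ∀ (t : ℝ) (x v : V3),
    deriv (fun s => h s x v) t +
        (∑ i : Fin 3, v i * fderiv ℝ (fun y => h t y v) x (EuclideanSpace.single i 1)) +
        Lam γ ϖ R χ (fun w => h t x w) v = src t x v

/-- The wave approximations `h⁽⁰⁾,…,h⁽³⁾` from initial data `f₀`. -/
def IsWaveSeq (γ ϖ R : ℝ) (χ : ℝ → ℝ) (f0 : V3 → V3 → ℝ)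
    (h : ℕ → ℝ → V3 → V3 → ℝ) : Prop :=
  IsDampedSol γ ϖ R χ (fun _ _ _ => 0) (h 0) ∧ (∀ x v : V3, h 0 0 x v = f0 x v) ∧
  ∀ j : ℕ, 1 ≤ j → j ≤ 3 →
    IsDampedSol γ ϖ R χ (fun t x v => Kop ϖ R χ (fun w => h (j - 1) t x w) v) (h j) ∧
    ∀ x v : V3, h j 0 x v = 0

/-- Smooth rapidly-decaying solution of the Fokker–Planck equation `∂ₜ f + v·∇ₓ f = L f`. -/
def IsFPSol (γ : ℝ) (f0 : V3 → V3 → ℝ) (f : ℝ → V3 → V3 → ℝ) : Prop :=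
  ContDiff ℝ (⊤ : ℕ∞) (fun p : ℝ × V3 × V3 => f p.1 p.2.1 p.2.2) ∧
  (∀ t : ℝ, RapidDecay (f t)) ∧
  (∀ x v : V3, f 0 x v = f0 x v) ∧
  ∀ (t : ℝ) (x v : V3),
    deriv (fun s => f s x v) t +
        (∑ i : Fin 3, v i * fderiv ℝ (fun y => f t y v) x (EuclideanSpace.single i 1)) =
      Lop γ (fun w => f t x w) v

/-- Weight function `c(x,v)`. -/
def cW (γ δ : ℝ) (χ : ℝ → ℝ) (x v : V3) : ℝ :=
  5 * (δ * jap x) ^ (γ / (3 - γ)) * (1 - χ (δ * jap x * jap v ^ (γ - 3))) +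
    ((1 - χ (δ * jap x * jap v ^ (γ - 3))) * (δ * jap x) * jap v ^ (2 * γ - 3) +
        3 * jap v ^ γ) *
      χ (δ * jap x * jap v ^ (γ - 3))

/-- Weighted `L²` norm. -/
def L2W (μ g : V3 → V3 → ℝ) : ℝ :=
  Real.sqrt (∫ x : V3, ∫ v : V3, g x v ^ 2 * μ x v)

/-- Weighted `L²_σ` square norm. -/
def sigmaSq (γ : ℝ) (μ g : V3 → V3 → ℝ) : ℝ :=
  ∫ x : V3, ∫ v : V3,
    (jap v ^ (2 * (γ - 1)) * g x v ^ 2 + ‖gradient (g x) v‖ ^ 2) * μ x v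

/-- Partial derivative in the space variable in direction `i`. -/
def pxd (i : Fin 3) (g : V3 → V3 → ℝ) : V3 → V3 → ℝ :=
  fun x v => fderiv ℝ (fun y => g y v) x (EuclideanSpace.single i 1)

/-- Iterated spatial partial derivatives. -/
def pxds : List (Fin 3) → (V3 → V3 → ℝ) → V3 → V3 → ℝ
  | [], g => g
  | i :: l, g => pxd i (pxds l g)

/-- Weighted `H^k_x L²_v` norm. -/
def HkW (μ : V3 → V3 → ℝ) (k : ℕ) (g : V3 → V3 → ℝ) : ℝ :=
  ∑ n ∈ Finset.range (k + 1), ∑ d : Fin n → Fin 3,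
    Real.sqrt (∫ x : V3, ∫ v : V3, pxds (List.ofFn d) g x v ^ 2 * μ x v)

/-- Weighted `L²` norm of all `x`-derivatives of order exactly `k`. -/
def NxkW (μ : V3 → V3 → ℝ) (k : ℕ) (g : V3 → V3 → ℝ) : ℝ :=
  Real.sqrt (∑ d : Fin k → Fin 3,
    ∫ x : V3, ∫ v : V3, pxds (List.ofFn d) g x v ^ 2 * μ x v)

/-- The weighted norm `|g|²_{L²_{σ̃,θ}}`. -/
def sigTildeSq (γ θ : ℝ) (g : V3 → ℝ) : ℝ :=
  (∫ v : V3, jap v ^ (2 * θ) * ‖gradient g v‖ ^ 2) +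
    ∫ v : V3, jap v ^ (2 * θ) * (‖v‖ ^ 2 * jap v ^ (2 * γ - 4) / 2) * g v ^ 2

theorem jap_one_le (v : V3) : 1 ≤ jap v := by
  unfold jap
  rw [Real.one_le_sqrt]
  nlinarith [sq_nonneg ‖v‖]

theorem jap_pos (v : V3) : 0 < jap v := lt_of_lt_of_le one_pos (jap_one_le v)

theorem jap_sq (v : V3) : jap v ^ 2 = 1 + ‖v‖ ^ 2 := by
  unfold jap
  exact Real.sq_sqrt (by positivity)

theorem jap_rpow (v : V3) (s : ℝ) : jap v ^ s = (1 + ‖v‖ ^ 2) ^ (s / 2) := by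
  unfold jap
  rw [Real.sqrt_eq_rpow, ← Real.rpow_mul (by positivity)]
  congr 1; ring

theorem jap_cont : Continuous jap := by
  unfold jap; fun_prop

theorem jap_rpow_cont (s : ℝ) : Continuous (fun v => jap v ^ s) :=
  jap_cont.rpow_const (fun v => Or.inl (jap_pos v).ne')

theorem hasFD (r : ℝ) (v : V3) :
    HasFDerivAt (fun w : V3 => (1 + ‖w‖ ^ 2) ^ r)
      ((2 * r * (1 + ‖v‖ ^ 2) ^ (r - 1)) • innerSL ℝ v) v := by
  have h1 : HasFDerivAt (fun w : V3 => 1 + ‖w‖ ^ 2) (2 • innerSL ℝ v) v :=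
    (hasStrictFDerivAt_norm_sq v).hasFDerivAt.const_add 1
  have h2 := h1.rpow_const (p := r) (Or.inl (by positivity))
  have e : (2 * r * (1 + ‖v‖ ^ 2) ^ (r - 1)) • innerSL ℝ v =
      (r * (1 + ‖v‖ ^ 2) ^ (r - 1)) • (2 • innerSL ℝ v) := by
    rw [two_nsmul, ← two_smul ℝ, smul_smul]
    congr 1; ring
  rw [e]
  exact h2

theorem innerE (v : V3) (i : Fin 3) :
    innerSL ℝ v (EuclideanSpace.single i (1:ℝ)) = v i := by
  simp [EuclideanSpace.inner_single_right]

theorem fd_Phi (γ : ℝ) (hγ : 0 < γ) (Φ0 : ℝ) (v : V3) (i : Fin 3) :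
    fderiv ℝ (Phi γ Φ0) v (EuclideanSpace.single i 1) = (1 + ‖v‖ ^ 2) ^ (γ / 2 - 1) * v i := by
  have h : HasFDerivAt (Phi γ Φ0) ((1 / γ) • ((2 * (γ / 2) * (1 + ‖v‖ ^ 2) ^ (γ / 2 - 1)) • innerSL ℝ v)) v := by
    have := ((hasFD (γ / 2) v).const_mul (1 / γ)).add_const Φ0
    have e : Phi γ Φ0 = fun x => 1 / γ * (1 + ‖x‖ ^ 2) ^ (γ / 2) + Φ0 := by
      funext w
      simp only [Phi, jap_rpow]
    rw [e]
    exact this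
  rw [h.fderiv]
  rw [ContinuousLinearMap.smul_apply, ContinuousLinearMap.smul_apply, innerE]
  simp only [smul_eq_mul]
  field_simp

theorem fd2_Phi (γ : ℝ) (hγ : 0 < γ) (Φ0 : ℝ) (v : V3) (i : Fin 3) :
    fderiv ℝ (fun w => fderiv ℝ (Phi γ Φ0) w (EuclideanSpace.single i 1)) v
      (EuclideanSpace.single i 1) =
      jap v ^ (γ - 2) + (γ - 2) * jap v ^ (γ - 4) * v i ^ 2 := by
  simp only [fd_Phi γ hγ]
  have h2 : HasFDerivAt (fun w : V3 => w i) (EuclideanSpace.proj i : V3 →L[ℝ] ℝ) v :=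
    (EuclideanSpace.proj i : V3 →L[ℝ] ℝ).hasFDerivAt
  have h := (hasFD (γ / 2 - 1) v).mul h2
  rw [show (fun w : V3 => (1 + ‖w‖ ^ 2) ^ (γ / 2 - 1) * w i) =
    (fun w : V3 => (1 + ‖w‖ ^ 2) ^ (γ / 2 - 1)) * (fun w => w i) from rfl, h.fderiv]
  rw [ContinuousLinearMap.add_apply, ContinuousLinearMap.smul_apply,
    ContinuousLinearMap.smul_apply, ContinuousLinearMap.smul_apply, innerE]
  simp only [jap_rpow, smul_eq_mul]
  rw [show (γ - 2) / 2 = γ / 2 - 1 by ring, show (γ - 4) / 2 = γ / 2 - 1 - 1 by ring]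
  simp
  ring

theorem lap_Phi (γ : ℝ) (hγ : 0 < γ) (Φ0 : ℝ) (v : V3) :
    lap (Phi γ Φ0) v = 3 * jap v ^ (γ - 2) + (γ - 2) * jap v ^ (γ - 4) * ‖v‖ ^ 2 := by
  unfold lap
  simp only [fd2_Phi γ hγ]
  rw [EuclideanSpace.norm_sq_eq]
  simp [Fin.sum_univ_three]
  ring

theorem lap_bound (γ : ℝ) (hγ : 0 < γ) (Φ0 : ℝ) (v : V3) :
    |lap (Phi γ Φ0) v / 2| ≤ (3 + |γ - 2|) * jap v ^ (γ - 2) := by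
  have hj := jap_pos v
  have e : jap v ^ (γ - 2) = jap v ^ (γ - 4) * jap v ^ 2 := by
    rw [← Real.rpow_natCast, ← Real.rpow_add hj]; congr 1; norm_num; ring
  have hp : 0 < jap v ^ (γ - 4) := Real.rpow_pos_of_pos hj _
  have h1 : jap v ^ (γ - 4) * ‖v‖ ^ 2 ≤ jap v ^ (γ - 2) := by
    rw [e, jap_sq]; nlinarith
  have h0 : 0 ≤ jap v ^ (γ - 4) * ‖v‖ ^ 2 := by positivity
  have h2 : 0 < jap v ^ (γ - 2) := Real.rpow_pos_of_pos hj _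
  rw [lap_Phi γ hγ]
  have h3 : |(γ - 2) * jap v ^ (γ - 4) * ‖v‖ ^ 2| ≤ |γ - 2| * jap v ^ (γ - 2) := by
    rw [mul_assoc, abs_mul, abs_of_nonneg h0]
    gcongr
  have h4 := abs_nonneg (γ - 2)
  rw [abs_le] at h3 ⊢
  constructor <;> nlinarith [h3.1, h3.2, mul_nonneg h4 h2.le]

/-- Weighted Cauchy-Schwarz. -/
theorem wCS (μ : Measure V3) (W f g : V3 → ℝ) (hW : ∀ v, 0 ≤ W v) (hWc : Continuous W)
    (hf : Continuous f) (hg : Continuous g)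
    (If : Integrable (fun v => W v * f v ^ 2) μ) (Ig : Integrable (fun v => W v * g v ^ 2) μ) :
    Integrable (fun v => W v * |f v * g v|) μ ∧
    ∫ v, W v * |f v * g v| ∂μ ≤
      Real.sqrt (∫ v, W v * f v ^ 2 ∂μ) * Real.sqrt (∫ v, W v * g v ^ 2 ∂μ) := by
  have sq : ∀ (f : V3 → ℝ) v, (Real.sqrt (W v) * |f v|) ^ 2 = W v * f v ^ 2 := by
    intro f v
    rw [mul_pow, Real.sq_sqrt (hW v), sq_abs]
  have key : ∀ f : V3 → ℝ, Continuous f → Integrable (fun v => W v * f v ^ 2) μ →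
      MemLp (fun v => Real.sqrt (W v) * |f v|) 2 μ := by
    intro f hf If
    rw [memLp_two_iff_integrable_sq (by
      exact (hWc.sqrt.mul hf.abs).aestronglyMeasurable)]
    simpa only [sq] using If
  have e : ∀ v, W v * |f v * g v| = (Real.sqrt (W v) * |f v|) * (Real.sqrt (W v) * |g v|) := by
    intro v
    rw [abs_mul]
    nth_rw 1 [← Real.mul_self_sqrt (hW v)]
    ring
  have mf := key f hf If
  have mg := key g hg Ig
  simp only [e]
  refine ⟨mf.integrable_mul mg, ?_⟩
  have h := integral_mul_le_Lp_mul_Lq_of_nonneg (μ := μ) Real.HolderConjugate.two_two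
    (f := fun v => Real.sqrt (W v) * |f v|) (g := fun v => Real.sqrt (W v) * |g v|)
    (Filter.Eventually.of_forall fun v => by positivity)
    (Filter.Eventually.of_forall fun v => by positivity)
    (by simpa using mf) (by simpa using mg)
  simp only [Real.rpow_two, sq, ← Real.sqrt_eq_rpow] at h
  exact h

theorem int_W (W : V3 → ℝ) (s : ℝ) (hWc : Continuous W) (hW : ∀ v, |W v| ≤ jap v ^ s)
    (g : SchwartzMap V3 ℝ) : Integrable (fun v => W v * g v ^ 2) := by
  have ht := Function.hasTemperateGrowth_one_add_norm_sq_rpow V3 (s / 2)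
  have h2 := (SchwartzMap.memLp (SchwartzMap.smulLeftCLM ℝ (fun v : V3 => (1 + ‖v‖ ^ 2) ^ (s / 2)) g) 2
    volume).integrable_mul (SchwartzMap.memLp g 2 volume)
  refine h2.mono (hWc.mul (g.continuous.pow 2)).aestronglyMeasurable
    (Filter.Eventually.of_forall fun v => ?_)
  simp only [Pi.mul_apply, SchwartzMap.smulLeftCLM_apply_apply ht, smul_eq_mul]
  rw [← jap_rpow, pow_two, ← mul_assoc, norm_mul, norm_mul, norm_mul, norm_mul]
  gcongr
  rw [Real.norm_eq_abs, Real.norm_eq_abs]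
  exact (hW v).trans (le_abs_self _)

/-- Weighted estimate for the potential term. -/
theorem weighted_potential_estimate (γ : ℝ) (hγ : 0 < γ) (θ Φ0 : ℝ)
    (hM : ∫ v : V3, Real.exp (-(Phi γ Φ0 v)) = 1) :
    ∃ C : ℝ, 0 < C ∧ ∀ m : ℝ, 1 < m → ∃ Cm : ℝ, 0 < Cm ∧
      ∀ g₁ g₂ : SchwartzMap V3 ℝ,
        |∫ v : V3, jap v ^ (2 * θ) * (lap (Phi γ Φ0) v / 2) * (g₁ v * g₂ v)| ≤
          C / m ^ γ * Real.sqrt (sigTildeSq γ θ fun w => g₁ w) *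
              Real.sqrt (sigTildeSq γ θ fun w => g₂ w) +
            Cm * Real.sqrt (∫ v in {v : V3 | ‖v‖ ≤ m}, jap v ^ (2 * θ) * g₁ v ^ 2) *
              Real.sqrt (∫ v in {v : V3 | ‖v‖ ≤ m}, jap v ^ (2 * θ) * g₂ v ^ 2) := by
  obtain ⟨K, hK, hKb⟩ : ∃ K : ℝ, 0 < K ∧ ∀ v, |lap (Phi γ Φ0) v / 2| ≤ K * jap v ^ (γ - 2) :=
    ⟨3 + |γ - 2|, by positivity, lap_bound γ hγ Φ0⟩
  refine ⟨4 * K, by positivity, fun m hm => ?_⟩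
  have hm0 : 0 < m := by linarith
  refine ⟨K * Real.sqrt (1 + m ^ 2) ^ γ, by positivity, fun g₁ g₂ => ?_⟩
  set Cm := K * Real.sqrt (1 + m ^ 2) ^ γ with hCm
  set W : V3 → ℝ := fun v => jap v ^ (2 * θ) * (‖v‖ ^ 2 * jap v ^ (2 * γ - 4) / 2) with hWdef
  set W0 : V3 → ℝ := fun v => jap v ^ (2 * θ) with hW0def
  set B : Set V3 := {v : V3 | ‖v‖ ≤ m} with hB
  have hBm : MeasurableSet B := (isClosed_le continuous_norm continuous_const).measurableSet
  have hWc : Continuous W :=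
    (jap_rpow_cont _).mul (((continuous_norm.pow 2).mul (jap_rpow_cont _)).div_const 2)
  have hW0c : Continuous W0 := jap_rpow_cont _
  have hW0n : ∀ v, 0 ≤ W0 v := fun v => (Real.rpow_pos_of_pos (jap_pos v) _).le
  have hWn : ∀ v, 0 ≤ W v := fun v => by
    have := Real.rpow_pos_of_pos (jap_pos v) (2 * θ)
    have := Real.rpow_pos_of_pos (jap_pos v) (2 * γ - 4)
    simp only [hWdef]; positivity
  have hWb : ∀ v, |W v| ≤ jap v ^ (2 * θ + (2 * γ - 2)) := fun v => by
    rw [abs_of_nonneg (hWn v), Real.rpow_add (jap_pos v)]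
    have h1 := Real.rpow_pos_of_pos (jap_pos v) (2 * θ)
    have h2 := Real.rpow_pos_of_pos (jap_pos v) (2 * γ - 4)
    have e : jap v ^ (2 * γ - 2) = jap v ^ (2 * γ - 4) * (1 + ‖v‖ ^ 2) := by
      rw [← jap_sq, ← Real.rpow_natCast, ← Real.rpow_add (jap_pos v)]
      congr 1; norm_num; ring
    simp only [hWdef]
    rw [e]
    gcongr
    nlinarith [mul_nonneg h2.le (sq_nonneg ‖v‖)]
  have IW := int_W W _ hWc hWb
  have IW0 := int_W W0 (2 * θ) hW0c (fun v => (abs_of_nonneg (hW0n v)).le)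
  obtain ⟨i1, b1⟩ := wCS volume W g₁ g₂ hWn hWc g₁.continuous g₂.continuous (IW g₁) (IW g₂)
  obtain ⟨i2, b2⟩ := wCS (volume.restrict B) W0 g₁ g₂ hW0n hW0c g₁.continuous g₂.continuous
    (IW0 g₁).restrict (IW0 g₂).restrict
  have hsig : ∀ g : V3 → ℝ, ∫ v, W v * g v ^ 2 ≤ sigTildeSq γ θ g := by
    intro g
    unfold sigTildeSq
    have : 0 ≤ ∫ v : V3, jap v ^ (2 * θ) * ‖gradient g v‖ ^ 2 :=
      integral_nonneg fun v => mul_nonneg (hW0n v) (sq_nonneg _)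
    linarith
  have hpt : ∀ v, ‖jap v ^ (2 * θ) * (lap (Phi γ Φ0) v / 2) * (g₁ v * g₂ v)‖ ≤
      4 * K / m ^ γ * (W v * |g₁ v * g₂ v|) +
        Cm * B.indicator (fun v => W0 v * |g₁ v * g₂ v|) v := by
    intro v
    have hj := jap_pos v
    have hX := abs_nonneg (g₁ v * g₂ v)
    have hw0 := hW0n v
    rw [norm_mul, norm_mul, Real.norm_eq_abs, Real.norm_eq_abs, Real.norm_eq_abs]
    rw [abs_of_nonneg (hW0n v)]
    have hmγ : 0 < m ^ γ := Real.rpow_pos_of_pos hm0 _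
    by_cases hv : v ∈ B
    · rw [Set.indicator_of_mem hv]
      have hjm : jap v ≤ Real.sqrt (1 + m ^ 2) := by
        have : ‖v‖ ≤ m := hv
        unfold jap
        gcongr
      have h1 : |lap (Phi γ Φ0) v / 2| ≤ Cm := by
        refine (hKb v).trans ?_
        rw [hCm]
        gcongr
        exact (Real.rpow_le_rpow_of_exponent_le (jap_one_le v) (by linarith)).trans
          (Real.rpow_le_rpow hj.le hjm hγ.le)
      have h2 : 0 ≤ 4 * K / m ^ γ * (W v * |g₁ v * g₂ v|) := by
        have := hWn v
        positivity
      calc _ ≤ W0 v * Cm * |g₁ v * g₂ v| := by gcongr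
        _ = Cm * (W0 v * |g₁ v * g₂ v|) := by ring
        _ ≤ _ := by linarith
    · rw [Set.indicator_of_notMem hv, mul_zero, add_zero]
      have hv' : m < ‖v‖ := not_le.mp hv
      have hmj : m ≤ jap v := by
        unfold jap
        apply Real.le_sqrt_of_sq_le
        nlinarith
      have h1 : m ^ γ ≤ jap v ^ γ := Real.rpow_le_rpow hm0.le hmj hγ.le
      have h4 := Real.rpow_pos_of_pos hj (2 * γ - 4)
      have e : jap v ^ (γ - 2) * jap v ^ γ = jap v ^ (2 * γ - 4) * (1 + ‖v‖ ^ 2) := by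
        rw [← jap_sq, ← Real.rpow_natCast, ← Real.rpow_add hj, ← Real.rpow_add hj]
        congr 1; norm_num; ring
      have h5 : jap v ^ (γ - 2) ≤ 2 * (‖v‖ ^ 2 * jap v ^ (2 * γ - 4)) / m ^ γ := by
        rw [le_div_iff₀ hmγ]
        have h6 := Real.rpow_pos_of_pos hj (γ - 2)
        calc _ ≤ jap v ^ (γ - 2) * jap v ^ γ := by gcongr
          _ = jap v ^ (2 * γ - 4) * (1 + ‖v‖ ^ 2) := e
          _ ≤ jap v ^ (2 * γ - 4) * (2 * ‖v‖ ^ 2) := by gcongr; nlinarith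
          _ = _ := by ring
      calc _ ≤ W0 v * (K * (2 * (‖v‖ ^ 2 * jap v ^ (2 * γ - 4)) / m ^ γ)) * |g₁ v * g₂ v| := by
            have := (hKb v).trans (mul_le_mul_of_nonneg_left h5 hK.le)
            gcongr
        _ = _ := by simp only [hWdef, hW0def]; ring
  have i2' : Integrable (B.indicator (fun v => W0 v * |g₁ v * g₂ v|)) :=
    (integrable_indicator_iff hBm).2 i2
  have main := norm_integral_le_of_norm_le ((i1.const_mul (4 * K / m ^ γ)).add (i2'.const_mul Cm))
    (Filter.Eventually.of_forall hpt)
  simp only [Pi.add_apply] at main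
  rw [integral_add (i1.const_mul _) (i2'.const_mul _), integral_const_mul, integral_const_mul,
    integral_indicator hBm] at main
  refine main.trans ?_
  have hCm0 : 0 ≤ Cm := by positivity
  have hC0 : 0 ≤ 4 * K / m ^ γ := by positivity
  have b1' : ∫ v, W v * |g₁ v * g₂ v| ≤ Real.sqrt (sigTildeSq γ θ fun w => g₁ w) *
      Real.sqrt (sigTildeSq γ θ fun w => g₂ w) :=
    b1.trans (mul_le_mul (Real.sqrt_le_sqrt (hsig _)) (Real.sqrt_le_sqrt (hsig _))
      (Real.sqrt_nonneg _) (Real.sqrt_nonneg _))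
  have r1 := mul_le_mul_of_nonneg_left b1' hC0
  have r2 := mul_le_mul_of_nonneg_left b2 hCm0
  rw [← mul_assoc] at r1 r2
  exact add_le_add r1 r2
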